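/- Assume condition (C_g)(a), let c > 0, and let d* > c be the number with D = (c, d*). Then for each d₀ > d* there exists a time τ₀ = τ₀(d₀) ∈ (1, ∞) such that z^{d₀}(t) < 1 for all 0 < t < τ₀ and z^{d₀}(τ₀) = 1. -/

import Mathlib

open Real Set Filter Topology MeasureTheory

noncomputable section

/-- Condition `(C_g)(a)`: `g` maps `[0,∞)` into `[0,1]`, the restriction of `g` to `[0,1]`
is `C¹` with derivative `g'` (one-sided at the endpoints), `g = 0` on `(1,∞)`,
`g 0 = g' 0 = 0`, `g 1 = 1`, and `g' ξ > g ξ / ξ` for all `ξ ∈ (0,1]`. -/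
structure CgA (g g' : ℝ → ℝ) : Prop where
  maps_to : ∀ ξ : ℝ, 0 ≤ ξ → g ξ ∈ Icc (0:ℝ) 1
  hasDeriv : ∀ ξ ∈ Icc (0:ℝ) 1, HasDerivWithinAt g (g' ξ) (Icc (0:ℝ) 1) ξ
  derivCont : ContinuousOn g' (Icc (0:ℝ) 1)
  eq_zero : ∀ ξ : ℝ, 1 < ξ → g ξ = 0
  g_zero : g 0 = 0
  g'_zero : g' 0 = 0
  g_one : g 1 = 1
  slope : ∀ ξ : ℝ, 0 < ξ → ξ ≤ 1 → g ξ / ξ < g' ξ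

/-- `x` is a (nonnegative, continuous) solution on `ℝ` of the delay equation
`x'(t) = -a·x(t) + b·F(x(t-1))`, in integral form. -/
def IsSolR (a b : ℝ) (F x : ℝ → ℝ) : Prop :=
  Continuous x ∧ (∀ t : ℝ, 0 ≤ x t) ∧
    ∀ τ t : ℝ, τ < t →
      IntervalIntegrable (fun s => Real.exp (-a * (t - s)) * F (x (s - 1))) volume τ t ∧
      x t = Real.exp (-a * (t - τ)) * x τ
          + b * ∫ s in τ..t, Real.exp (-a * (t - s)) * F (x (s - 1))

/-- `x` is a (nonnegative, continuous) solution on `[T₁ - 1, ∞)` of the delay equation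
`x'(t) = -a·x(t) + b·F(x(t-1))`, in integral form (identity for `T₁ ≤ τ < t`). -/
def IsSolOn (a b : ℝ) (F : ℝ → ℝ) (T₁ : ℝ) (x : ℝ → ℝ) : Prop :=
  ContinuousOn x (Ici (T₁ - 1)) ∧ (∀ t : ℝ, T₁ - 1 ≤ t → 0 ≤ x t) ∧
    ∀ τ t : ℝ, T₁ ≤ τ → τ < t →
      IntervalIntegrable (fun s => Real.exp (-a * (t - s)) * F (x (s - 1))) volume τ t ∧
      x t = Real.exp (-a * (t - τ)) * x τ
          + b * ∫ s in τ..t, Real.exp (-a * (t - s)) * F (x (s - 1))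

/-- `z` is the solution of `(E_g)` on `[0,∞)` with initial segment `z t = e^{-c t}` on `[0,1]`. -/
def IsZSol (c d : ℝ) (g z : ℝ → ℝ) : Prop :=
  IsSolOn c d g 1 z ∧ ∀ t ∈ Icc (0:ℝ) 1, z t = Real.exp (-c * t)

/-- Condition `(C_{f_n})(a)(b)`: `a n → c`, `b n → d`, each `f n : [0,∞) → [0,1)` is `C¹`
with derivative `f' n`, `f n 0 = 0`, `f' n > 0` on `(0,1/2]`, the uniform closeness of
`(f n, f' n)` to `(g, g')` away from `1`, and the smallness of
`sup_{[1+κ,∞)}|f' n| · (sup_{[0,∞)}|f' n|)^m`. -/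
structure Cfn (c d : ℝ) (g g' : ℝ → ℝ) (a b : ℕ → ℝ) (f f' : ℕ → ℝ → ℝ) : Prop where
  a_pos : ∀ n, 0 < a n
  b_pos : ∀ n, 0 < b n
  a_lim : Tendsto a atTop (nhds c)
  b_lim : Tendsto b atTop (nhds d)
  maps_to : ∀ n, ∀ ξ : ℝ, 0 ≤ ξ → f n ξ ∈ Ico (0:ℝ) 1
  hasDeriv : ∀ n, ∀ ξ : ℝ, 0 ≤ ξ → HasDerivWithinAt (f n) (f' n ξ) (Ici (0:ℝ)) ξ
  derivCont : ∀ n, ContinuousOn (f' n) (Ici (0:ℝ))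
  f_zero : ∀ n, f n 0 = 0
  f'_pos : ∀ n, ∀ ξ : ℝ, 0 < ξ → ξ ≤ 1/2 → 0 < f' n ξ
  close : ∀ κ : ℝ, 0 < κ → κ < 1 → ∀ ε : ℝ, 0 < ε → ∃ N : ℕ, ∀ n ≥ N,
      ∀ ξ : ℝ, (ξ ∈ Icc (0:ℝ) (1 - κ) ∨ 1 + κ ≤ ξ) →
        |f n ξ - g ξ| + |f' n ξ - g' ξ| < ε
  small : ∀ κ : ℝ, 0 < κ → κ < 1 → ∀ m : ℕ, ∃ A B : ℕ → ℝ,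
      (∀ n, ∀ ξ : ℝ, 1 + κ ≤ ξ → |f' n ξ| ≤ A n) ∧
      (∀ n, ∀ ξ : ℝ, 0 ≤ ξ → |f' n ξ| ≤ B n) ∧
      Tendsto (fun n => A n * (B n) ^ m) atTop (nhds 0)

/-- Condition `(H)`. -/
structure CondH (a b ξm ξp : ℝ) (h : ℝ → ℝ) : Prop where
  a_pos : 0 < a
  b_pos : 0 < b
  ξm_neg : ξm < 0
  ξp_pos : 0 < ξp
  bdd : ∃ M : ℝ, ∀ ξ : ℝ, |h ξ| ≤ M
  smooth : ContDiff ℝ 1 h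
  h_zero : h 0 = 0
  slope_zero : a < b * deriv h 0
  zero_m : -a * ξm + b * h ξm = 0
  zero_p : -a * ξp + b * h ξp = 0
  ratio : ∀ ξ : ℝ, ξm < ξ → ξ < ξp → ξ ≠ 0 → a / b < h ξ / ξ
  deriv_pos : ∀ ξ : ℝ, ξ ≠ ξm → ξ ≠ ξp → 0 < deriv h ξ

/-- Solution of `(E_h)`: `u'(t) = -a·u(t) + b·h(u(t-1))` on all of `ℝ`. -/
def IsSolH (a b : ℝ) (h u : ℝ → ℝ) : Prop :=
  ∀ t : ℝ, HasDerivAt u (-a * u t + b * h (u (t - 1))) t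

/-- Solution of `(E_h)` on `[-1,∞)`: continuous there, differentiable on `(0,∞)`
and satisfying the equation for `t > 0`. -/
def IsSolHOn (a b : ℝ) (h u : ℝ → ℝ) : Prop :=
  ContinuousOn u (Ici (-1:ℝ)) ∧
    ∀ t : ℝ, 0 < t → HasDerivAt u (-a * u t + b * h (u (t - 1))) t

/-- Solution of `(E_h)` on `(-∞,0]`. -/
def IsSolHIic (a b : ℝ) (h u : ℝ → ℝ) : Prop :=
  ContinuousOn u (Iic (0:ℝ)) ∧
    ∀ t : ℝ, t ≤ 0 → HasDerivWithinAt u (-a * u t + b * h (u (t - 1))) (Iic (0:ℝ)) t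

lemma aux_contOn {g g' : ℝ → ℝ} (hg : CgA g g') : ContinuousOn g (Icc (0:ℝ) 1) :=
  fun x hx => (hg.hasDeriv x hx).continuousWithinAt

lemma aux_hasDeriv {g g' : ℝ → ℝ} (hg : CgA g g') (x : ℝ) (h0 : 0 < x) (h1 : x < 1) :
    HasDerivAt g (g' x) x :=
  (hg.hasDeriv x ⟨h0.le, h1.le⟩).hasDerivAt (Icc_mem_nhds h0 h1)

lemma aux_mono {g g' : ℝ → ℝ} (hg : CgA g g') : StrictMonoOn g (Icc (0:ℝ) 1) := by
  apply strictMonoOn_of_deriv_pos (convex_Icc 0 1) (aux_contOn hg)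
  intro x hx
  rw [interior_Icc] at hx
  rw [(aux_hasDeriv hg x hx.1 hx.2).deriv]
  exact lt_of_le_of_lt (div_nonneg (hg.maps_to x hx.1.le).1 hx.1.le) (hg.slope x hx.1 hx.2.le)

lemma aux_ratio {g g' : ℝ → ℝ} (hg : CgA g g') : MonotoneOn (fun x => g x / x) (Ioc (0:ℝ) 1) := by
  have hd : ∀ x ∈ Ioo (0:ℝ) 1,
      HasDerivAt (fun x => g x / x) ((g' x * x - g x * 1) / x ^ 2) x := by
    intro x hx
    exact (aux_hasDeriv hg x hx.1 hx.2).div (hasDerivAt_id x) hx.1.ne'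
  apply monotoneOn_of_deriv_nonneg (convex_Ioc 0 1)
  · exact ((aux_contOn hg).mono Ioc_subset_Icc_self).div continuousOn_id (fun x hx => hx.1.ne')
  · rw [interior_Ioc]
    exact fun x hx => (hd x hx).differentiableAt.differentiableWithinAt
  · rw [interior_Ioc]
    intro x hx
    rw [(hd x hx).deriv]
    have := hg.slope x hx.1 hx.2.le
    rw [div_lt_iff₀ hx.1] at this
    apply div_nonneg _ (sq_nonneg x)
    linarith

lemma aux_scale {g g' : ℝ → ℝ} (hg : CgA g g') (l v w : ℝ) (hl : 1 ≤ l) (hv : 0 ≤ v)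
    (hw : l * v ≤ w) (hw1 : w ≤ 1) : l * g v ≤ g w := by
  rcases hv.eq_or_lt with h | h
  · subst h
    rw [hg.g_zero, mul_zero]
    exact (hg.maps_to w (by linarith)).1
  · have h1 : v ≤ l * v := by nlinarith
    have h2 : 0 < l * v := by positivity
    have h3 := aux_ratio hg ⟨h, by linarith⟩ ⟨h2, by linarith⟩ h1
    have h4 : g (l * v) ≤ g w :=
      (aux_mono hg).monotoneOn ⟨h2.le, by linarith⟩ ⟨by linarith, hw1⟩ hw
    simp only at h3
    rw [div_le_div_iff₀ h h2] at h3
    have : l * g v * v ≤ g (l * v) * v := by linarith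
    linarith [le_of_mul_le_mul_right this h]

lemma aux_small {g g' : ℝ → ℝ} (hg : CgA g g') (ε : ℝ) (hε : 0 < ε) :
    ∃ η : ℝ, 0 < η ∧ η ≤ 1 ∧ ∀ x, 0 ≤ x → x ≤ η → g x ≤ ε * x := by
  have h := hg.hasDeriv 0 ⟨le_rfl, zero_le_one⟩
  rw [hg.g'_zero, hasDerivWithinAt_iff_isLittleO] at h
  have h2 := h.def hε
  rw [eventually_nhdsWithin_iff, Metric.eventually_nhds_iff] at h2
  obtain ⟨δ, hδ, h3⟩ := h2
  refine ⟨min 1 (δ/2), by positivity, min_le_left _ _, ?_⟩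
  intro x hx0 hx
  have hx1 := hx.trans (min_le_left _ _)
  have hx2 := hx.trans (min_le_right _ _)
  have h4 := h3 (y := x) (by rw [Real.dist_eq, sub_zero, abs_of_nonneg hx0]; linarith) ⟨hx0, hx1⟩
  simp only [hg.g_zero, sub_zero, smul_zero, Real.norm_eq_abs, abs_of_nonneg hx0] at h4
  exact (le_abs_self _).trans h4

lemma aux_decay {c d : ℝ} {g g' v : ℝ → ℝ} (hg : CgA g g') (hd : 0 < d)
    (hv : IsSolOn c d g 1 v) (s t : ℝ) (hs : 1 ≤ s) (hst : s ≤ t) :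
    Real.exp (-c * (t - s)) * v s ≤ v t := by
  rcases hst.eq_or_lt with h | h
  · subst h; simp
  · rw [(hv.2.2 s t hs h).2]
    have : 0 ≤ ∫ u in s..t, Real.exp (-c * (t - u)) * g (v (u - 1)) := by
      apply intervalIntegral.integral_nonneg hst
      intro u hu
      exact mul_nonneg (Real.exp_pos _).le (hg.maps_to _ (hv.2.1 _ (by linarith [hu.1]))).1
    have := mul_nonneg hd.le this
    linarith

/-- comparison of integral terms -/
lemma aux_int {c d : ℝ} {g g' v : ℝ → ℝ} (hg : CgA g g') (hc : 0 < c) (hd : 0 < d)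
    (hv : IsSolOn c d g 1 v) (ε η : ℝ) (hε : 0 < ε) (hη : ∀ x, 0 ≤ x → x ≤ η → g x ≤ ε * x)
    (ρ : ℝ) (hρη : ρ ≤ η) (t : ℝ) (ht : 2 ≤ t)
    (hw : ∀ s, t - 2 ≤ s → s ≤ t - 1 → v s ≤ ρ) :
    v t ≤ (Real.exp (-c) + d * ε) * ρ := by
  have h := hv.2.2 (t-1) t (by linarith) (by linarith)
  rw [h.2]
  have h1 : ∫ u in (t-1)..t, Real.exp (-c * (t - u)) * g (v (u - 1)) ≤ ∫ u in (t-1)..t, ε * ρ := by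
    apply intervalIntegral.integral_mono_on (by linarith) h.1 (by simp)
    intro u hu
    have h0 := hv.2.1 (u-1) (by linarith [hu.1])
    have h2 := hw (u-1) (by linarith [hu.1]) (by linarith [hu.2])
    have h3 := hη _ h0 (h2.trans hρη)
    have h4 := (hg.maps_to _ h0).1
    have h5 : Real.exp (-c * (t - u)) ≤ 1 := by
      rw [Real.exp_le_one_iff]; nlinarith [hu.2]
    calc _ ≤ 1 * g (v (u-1)) := by gcongr
      _ ≤ ε * ρ := by rw [one_mul]; exact h3.trans (by gcongr)
  rw [intervalIntegral.integral_const] at h1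
  have h2 := hw (t-1) (by linarith) le_rfl
  have e1 : -c * (t - (t-1)) = -c := by ring
  rw [e1]
  have h3 := mul_le_mul_of_nonneg_left h2 (Real.exp_pos (-c)).le
  have h4 := mul_le_mul_of_nonneg_left h1 hd.le
  simp only [smul_eq_mul, sub_sub_cancel, one_mul] at h4
  linarith

lemma aux_persist {c d : ℝ} {g g' v : ℝ → ℝ} (hg : CgA g g') (hc : 0 < c) (hd : 0 < d)
    (hv : IsSolOn c d g 1 v) (hn : ¬ Tendsto v atTop (nhds 0)) :
    ∃ m : ℝ, 0 < m ∧ m ≤ 1 ∧ ∀ t, 3 ≤ t → m ≤ v t := by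
  have hec : Real.exp (-c) < 1 := by rw [Real.exp_lt_one_iff]; linarith
  obtain ⟨ε, hε, hθ⟩ : ∃ ε : ℝ, 0 < ε ∧ Real.exp (-c) + d * ε < 1 := by
    refine ⟨(1 - Real.exp (-c)) / (2 * d), by apply div_pos <;> linarith, ?_⟩
    have : d * ((1 - Real.exp (-c)) / (2 * d)) = (1 - Real.exp (-c)) / 2 := by field_simp
    rw [this]; linarith
  have hθ0 : 0 < Real.exp (-c) + d * ε := by positivity
  obtain ⟨η, hη0, hη1, hη⟩ := aux_small hg ε hε
  have hstep := aux_int hg hc hd hv ε η hε hη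
  set θ := Real.exp (-c) + d * ε with hθdef
  have key : ∀ T, 1 ≤ T → ∃ s, T ≤ s ∧ s ≤ T + 2 ∧ η < v s := by
    intro T hT
    by_contra hcon
    push Not at hcon
    apply hn
    have hall : ∀ k : ℕ, ∀ s, T ≤ s → s ≤ T + 2 + k → v s ≤ η := by
      intro k
      induction k with
      | zero => intro s h1 h2; exact hcon s h1 (by simpa using h2)
      | succ k ih =>
        intro s h1 h2
        push_cast at h2
        rcases le_total s (T + 2 + k) with h | h
        · exact ih s h1 h
        · have hk : (0:ℝ) ≤ k := Nat.cast_nonneg k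
          have := hstep η le_rfl s (by linarith)
            (fun u hu1 hu2 => ih u (by linarith) (by linarith))
          nlinarith
    have hpow : ∀ n : ℕ, ∀ t, T + 2 * n ≤ t → v t ≤ θ ^ n * η := by
      intro n
      induction n with
      | zero =>
        intro t ht
        simp only [Nat.cast_zero, mul_zero, add_zero] at ht
        obtain ⟨k, hk⟩ := exists_nat_ge (t - T - 2)
        simpa using hall k t ht (by linarith)
      | succ n ih =>
        intro t ht
        push_cast at ht
        have hk : (0:ℝ) ≤ n := Nat.cast_nonneg n
        have hp : θ ^ n ≤ 1 := pow_le_one₀ hθ0.le hθ.le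
        have := hstep (θ ^ n * η) (by nlinarith) t (by linarith)
          (fun u hu1 hu2 => ih u (by linarith))
        rw [pow_succ]; linarith
    have hlim : Tendsto (fun n : ℕ => θ ^ n * η) atTop (nhds 0) := by
      simpa using (tendsto_pow_atTop_nhds_zero_of_lt_one hθ0.le hθ).mul_const η
    rw [Metric.tendsto_atTop]
    intro e he
    obtain ⟨n, hn⟩ := (hlim.eventually (gt_mem_nhds he)).exists
    refine ⟨T + 2 * n, fun t ht => ?_⟩
    have hk : (0:ℝ) ≤ n := Nat.cast_nonneg n
    have h0 := hv.2.1 t (by linarith)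
    rw [Real.dist_eq, sub_zero, abs_of_nonneg h0]
    exact (hpow n t ht).trans_lt hn
  have he2 : Real.exp (-c * 2) ≤ 1 := by rw [Real.exp_le_one_iff]; linarith
  refine ⟨Real.exp (-c * 2) * η, by positivity, by nlinarith, ?_⟩
  intro t ht
  obtain ⟨s, hs1, hs2, hs⟩ := key (t - 2) (by linarith)
  refine le_trans ?_ (aux_decay hg hd hv s t (by linarith) (by linarith))
  have : Real.exp (-c * 2) ≤ Real.exp (-c * (t - s)) := by
    rw [Real.exp_le_exp]; nlinarith
  gcongr

lemma aux_compare {c d d' : ℝ} {g g' v w : ℝ → ℝ} (hg : CgA g g') (hd : 0 < d) (hdd : d ≤ d')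
    (hv : IsZSol c d g v) (hw : IsZSol c d' g w) (hw1 : ∀ t, 0 ≤ t → w t ≤ 1) :
    ∀ t, 0 ≤ t → v t ≤ w t := by
  have hall : ∀ n : ℕ, ∀ t : ℝ, 0 ≤ t → t ≤ 1 + n → v t ≤ w t := by
    intro n
    induction n with
    | zero =>
      intro t h0 h1
      simp only [Nat.cast_zero, add_zero] at h1
      rw [hv.2 t ⟨h0, h1⟩, hw.2 t ⟨h0, h1⟩]
    | succ n ih =>
      intro t h0 h1
      push_cast at h1
      rcases le_or_gt t 1 with h | h
      · rw [hv.2 t ⟨h0, h⟩, hw.2 t ⟨h0, h⟩]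
      have a := hv.1.2.2 1 t le_rfl h
      have b := hw.1.2.2 1 t le_rfl h
      rw [a.2, b.2, hv.2 1 ⟨zero_le_one, le_rfl⟩, hw.2 1 ⟨zero_le_one, le_rfl⟩]
      have hi : ∫ u in (1:ℝ)..t, Real.exp (-c * (t - u)) * g (v (u - 1))
          ≤ ∫ u in (1:ℝ)..t, Real.exp (-c * (t - u)) * g (w (u - 1)) := by
        apply intervalIntegral.integral_mono_on h.le a.1 b.1
        intro u hu
        have hu0 : 0 ≤ u - 1 := by linarith [hu.1]
        have h3 := ih (u-1) hu0 (by linarith [hu.2])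
        have h4 := hw1 (u-1) hu0
        have h5 := hv.1.2.1 (u-1) (by linarith)
        have := (aux_mono hg).monotoneOn ⟨h5, by linarith⟩ ⟨by linarith, h4⟩ h3
        gcongr
      have hi0 : 0 ≤ ∫ u in (1:ℝ)..t, Real.exp (-c * (t - u)) * g (w (u - 1)) := by
        apply intervalIntegral.integral_nonneg h.le
        intro u hu
        exact mul_nonneg (Real.exp_pos _).le (hg.maps_to _ (hw.1.2.1 _ (by linarith [hu.1]))).1
      have : d * ∫ u in (1:ℝ)..t, Real.exp (-c * (t - u)) * g (v (u - 1))
          ≤ d' * ∫ u in (1:ℝ)..t, Real.exp (-c * (t - u)) * g (w (u - 1)) :=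
        (mul_le_mul_of_nonneg_left hi hd.le).trans (mul_le_mul_of_nonneg_right hdd hi0)
      linarith
  intro t ht
  obtain ⟨n, hn⟩ := exists_nat_ge (t - 1)
  exact hall n t ht (by linarith)

lemma aux_ratio_step {c d d' : ℝ} {g g' v w : ℝ → ℝ} (hg : CgA g g') (hc : 0 < c) (hd : 0 < d)
    (hdd : d < d')
    (hv : IsSolOn c d g 1 v) (hw : IsSolOn c d' g 1 w) (hw1 : ∀ t, 0 ≤ t → w t ≤ 1)
    (m : ℝ) (hm : 0 < m) (hm1 : m ≤ 1) (l : ℝ) (hl : 1 ≤ l) (t : ℝ) (ht : 2 ≤ t)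
    (hmv : ∀ s, t - 2 ≤ s → s ≤ t - 1 → m ≤ v s)
    (hvw : ∀ s, t - 2 ≤ s → s ≤ t - 1 → l * v s ≤ w s) (hvt : v t ≤ 1) :
    l * (1 + (d' - d) * (Real.exp (-c) * g m)) * v t ≤ w t := by
  have a := hv.2.2 (t-1) t (by linarith) (by linarith)
  have b := hw.2.2 (t-1) t (by linarith) (by linarith)
  have hgm : 0 ≤ g m := (hg.maps_to m hm.le).1
  have h1 : ∫ u in (t-1)..t, l * (Real.exp (-c * (t - u)) * g (v (u - 1)))
      ≤ ∫ u in (t-1)..t, Real.exp (-c * (t - u)) * g (w (u - 1)) := by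
    apply intervalIntegral.integral_mono_on (by linarith) (a.1.const_mul l) b.1
    intro u hu
    have := aux_scale hg l (v (u-1)) (w (u-1)) hl (hv.2.1 _ (by linarith [hu.1]))
      (hvw _ (by linarith [hu.1]) (by linarith [hu.2])) (hw1 _ (by linarith [hu.1]))
    have := mul_le_mul_of_nonneg_left this (Real.exp_pos (-c * (t - u))).le
    linarith
  rw [intervalIntegral.integral_const_mul] at h1
  have h2 : ∫ u in (t-1)..t, Real.exp (-c) * g m
      ≤ ∫ u in (t-1)..t, Real.exp (-c * (t - u)) * g (v (u - 1)) := by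
    apply intervalIntegral.integral_mono_on (by linarith) (by simp) a.1
    intro u hu
    have h3 := hmv (u-1) (by linarith [hu.1]) (by linarith [hu.2])
    have h6 := hvw (u-1) (by linarith [hu.1]) (by linarith [hu.2])
    have h7 := hw1 (u-1) (by linarith [hu.1])
    have h4 : g m ≤ g (v (u-1)) :=
      (aux_mono hg).monotoneOn ⟨hm.le, hm1⟩ ⟨by linarith, by nlinarith⟩ h3
    have h5 : Real.exp (-c) ≤ Real.exp (-c * (t - u)) := by
      rw [Real.exp_le_exp]; nlinarith [hu.1]
    gcongr
  rw [intervalIntegral.integral_const] at h2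
  simp only [smul_eq_mul, sub_sub_cancel, one_mul] at h2
  have h3 := hvw (t-1) (by linarith) le_rfl
  have a2 := a.2
  have b2 := b.2
  have hvt0 := hv.2.1 t (by linarith)
  generalize (∫ u in (t-1)..t, Real.exp (-c * (t - u)) * g (v (u - 1))) = I at *
  generalize (∫ u in (t-1)..t, Real.exp (-c * (t - u)) * g (w (u - 1))) = J at *
  have hE := mul_le_mul_of_nonneg_left h3 (Real.exp_pos (-c * (t - (t-1)))).le
  have hK0 : 0 ≤ Real.exp (-c) * g m := by positivity
  generalize Real.exp (-c) * g m = K at *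
  generalize Real.exp (-c * (t - (t-1))) = E at *
  have hJ : d' * (l * I) ≤ d' * J := mul_le_mul_of_nonneg_left h1 (by linarith)
  have hKI : l * (d' - d) * K ≤ l * (d' - d) * I :=
    mul_le_mul_of_nonneg_left h2 (mul_nonneg (by linarith) (by linarith))
  have hKv : l * (d' - d) * K * v t ≤ l * (d' - d) * K * 1 :=
    mul_le_mul_of_nonneg_left hvt (mul_nonneg (mul_nonneg (by linarith) (by linarith)) hK0)
  have hlv : l * v t = l * (E * v (t-1) + d * I) := by rw [← a2]
  calc l * (1 + (d' - d) * K) * v t = l * v t + l * (d' - d) * K * v t := by ring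
    _ ≤ w t := by rw [hlv, b2]; linarith

lemma aux_main {c d d' : ℝ} {g g' v w : ℝ → ℝ} (hg : CgA g g') (hc : 0 < c) (hd : 0 < d)
    (hdd : d < d')
    (hv : IsZSol c d g v) (hw : IsZSol c d' g w) (hw1 : ∀ t, 0 ≤ t → w t ≤ 1)
    (hn : ¬ Tendsto v atTop (nhds 0)) : False := by
  obtain ⟨m, hm, hm1, hmv⟩ := aux_persist hg hc hd hv.1 hn
  have hcmp := aux_compare hg hd hdd.le hv hw hw1
  have hgm : 0 < g m := by
    have := aux_mono hg ⟨le_rfl, zero_le_one⟩ ⟨hm.le, hm1⟩ hm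
    rwa [hg.g_zero] at this
  have hq : 0 < (d' - d) * (Real.exp (-c) * g m) :=
    mul_pos (by linarith) (mul_pos (Real.exp_pos _) hgm)
  have hstep := fun l hl t ht => aux_ratio_step hg hc hd hdd hv.1 hw.1 hw1 m hm hm1 l hl t ht
  set q := (d' - d) * (Real.exp (-c) * g m) with hqd
  have hpow : ∀ n : ℕ, ∀ t, 3 + 2 * (n:ℝ) ≤ t → (1 + q) ^ n * v t ≤ w t := by
    intro n
    induction n with
    | zero => intro t ht; simp only [Nat.cast_zero] at ht; simpa using hcmp t (by linarith)
    | succ n ih =>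
      intro t ht
      push_cast at ht
      have hk : (0:ℝ) ≤ n := Nat.cast_nonneg n
      have := hstep ((1+q)^n) (one_le_pow₀ (by linarith)) t (by linarith)
        (fun s h1 h2 => hmv s (by linarith)) (fun s h1 h2 => ih s (by linarith))
        ((hcmp t (by linarith)).trans (hw1 t (by linarith)))
      rwa [pow_succ]
  obtain ⟨n, hn⟩ := pow_unbounded_of_one_lt (1 / m) (show 1 < 1 + q by linarith)
  have hk : (0:ℝ) ≤ n := Nat.cast_nonneg n
  have h1 := hpow n (3 + 2 * n) le_rfl
  have h2 := hmv (3 + 2 * n) (by linarith)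
  have h3 := hw1 (3 + 2 * n) (by linarith)
  rw [div_lt_iff₀ hm] at hn
  have h4 : (1 + q) ^ n * m ≤ (1 + q) ^ n * v (3 + 2 * n) := by gcongr
  linarith

/-- for `d₀ > d*`, the solution `z^{d₀}` reaches the value `1` at a first
time `τ₀ ∈ (1,∞)`. -/
theorem stmt_12 (c dstar : ℝ) (g g' : ℝ → ℝ) (hg : CgA g g') (hc : 0 < c)
    (z : ℝ → ℝ → ℝ) (hz : ∀ d : ℝ, c < d → IsZSol c d g (z d))
    (hds : c < dstar)
    (hD : {d : ℝ | c < d ∧ (∀ t : ℝ, 0 < t → z d t < 1) ∧ Tendsto (z d) atTop (nhds 0)}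
        = Ioo c dstar) :
    ∀ d₀ : ℝ, dstar < d₀ →
      ∃ τ₀ : ℝ, 1 < τ₀ ∧ (∀ t : ℝ, 0 < t → t < τ₀ → z d₀ t < 1) ∧ z d₀ τ₀ = 1 := by
  intro d₀ hd₀
  by_contra hno
  have hz0 := hz d₀ (by linarith)
  have hlt01 : ∀ t, 0 < t → t ≤ 1 → z d₀ t < 1 := by
    intro t h0 h1
    rw [hz0.2 t ⟨h0.le, h1⟩, Real.exp_lt_one_iff]
    nlinarith
  have hivt : ∀ t, 1 < t → 1 ≤ z d₀ t → ∃ s ∈ Icc 1 t, z d₀ s = 1 := by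
    intro t ht h1
    have hcont : ContinuousOn (z d₀) (Icc 1 t) :=
      hz0.1.1.mono (fun s hs => by simp only [mem_Ici]; linarith [hs.1])
    exact intermediate_value_Icc ht.le hcont ⟨(hlt01 1 one_pos le_rfl).le, h1⟩
  have hlt : ∀ t, 0 < t → z d₀ t < 1 := by
    intro t ht
    by_contra h
    push Not at h
    have ht1 : 1 < t := by
      by_contra h2
      push Not at h2
      linarith [hlt01 t ht h2]
    have hcont : ContinuousOn (z d₀) (Icc 1 t) :=
      hz0.1.1.mono (fun s hs => by simp only [mem_Ici]; linarith [hs.1])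
    have hcl : IsCompact (Icc 1 t ∩ z d₀ ⁻¹' {1}) :=
      isCompact_Icc.of_isClosed_subset
        (hcont.preimage_isClosed_of_isClosed isClosed_Icc isClosed_singleton) inter_subset_left
    obtain ⟨s, hs, hs1⟩ := hivt t ht1 h
    obtain ⟨τ, hτ⟩ := hcl.exists_isLeast ⟨s, hs, hs1⟩
    have hτ1 : z d₀ τ = 1 := hτ.1.2
    have hτt := hτ.1.1
    apply hno
    refine ⟨τ, ?_, ?_, hτ1⟩
    · rcases hτt.1.eq_or_lt with h2 | h2
      · rw [← h2] at hτ1; linarith [hlt01 1 one_pos le_rfl]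
      · exact h2
    · intro u hu0 hu
      by_contra h2
      push Not at h2
      have hu1 : 1 < u := by
        by_contra h3
        push Not at h3
        linarith [hlt01 u hu0 h3]
      obtain ⟨r, hr, hr1⟩ := hivt u hu1 h2
      have := hτ.2 ⟨⟨hr.1, by linarith [hr.2, hτt.2]⟩, hr1⟩
      linarith [hr.2]
  have hle : ∀ t, 0 ≤ t → z d₀ t ≤ 1 := by
    intro t ht
    rcases ht.eq_or_lt with h | h
    · rw [← h, hz0.2 0 ⟨le_rfl, zero_le_one⟩]; simp
    · exact (hlt t h).le
  have hcd : 0 < dstar := by linarith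
  refine aux_main hg hc hcd hd₀ (hz dstar hds) hz0 hle ?_
  intro hT
  have hmem : dstar ∈ Ioo c dstar := by
    rw [← hD]
    refine ⟨hds, fun t ht => ?_, hT⟩
    exact (aux_compare hg hcd hd₀.le (hz dstar hds) hz0 hle t ht.le).trans_lt (hlt t ht)
  exact lt_irrefl _ hmem.2
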